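/- For every n ≥ 4, every simple graph G on n vertices that is gap-vertex-labelable satisfies C(n,2) − |E(G)| ≥ (3/100)·n^{6/5}, where |E(G)| is the number of edges of G. Equivalently, the gap-strength of the complete graph K_n — the least number l of edges whose removal from K_n can yield a gap-vertex-labelable graph — satisfies str_gap(K_n) ≥ (3/100)·n^{6/5}, so str_gap(K_n) ∈ Ω(n^{6/5}). -/

import Mathlib

/-- The neighbourhood of `v` in `G` as a `Finset` (classically decidable). -/
noncomputable def gapNbhd {V : Type*} [Fintype V] (G : SimpleGraph V) (v : V) : Finset V :=
  @Finset.filter V (fun u => G.Adj v u) (Classical.decPred _) Finset.univ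

/-- The colouring induced by a vertex-labelling `π` : a vertex with at least two neighbours
gets the gap `max − min` of the labels of its neighbours, a vertex with exactly one neighbour
`u` gets `π u`, and an isolated vertex gets `1`. -/
noncomputable def gapColor {V : Type*} [Fintype V] (G : SimpleGraph V) (π : V → ℕ) (v : V) : ℕ :=
  if h : ((gapNbhd G v).image π).Nonempty then
    if 2 ≤ (gapNbhd G v).card then
      ((gapNbhd G v).image π).max' h - ((gapNbhd G v).image π).min' h
    else ((gapNbhd G v).image π).max' h
  else 1

/-- `π` is a gap-`[k]`-vertex-labelling of `G`: the labels lie in `{1, …, k}` and the induced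
colouring is proper. -/
def IsGapLabelling {V : Type*} [Fintype V] (G : SimpleGraph V) (k : ℕ) (π : V → ℕ) : Prop :=
  (∀ v, 1 ≤ π v ∧ π v ≤ k) ∧
  ∀ u v, G.Adj u v → gapColor G π u ≠ gapColor G π v

/-- `G` is gap-vertex-labelable if it admits a gap-`[k]`-vertex-labelling for some `k ≥ 1`. -/
def GapVertexLabelable {V : Type*} [Fintype V] (G : SimpleGraph V) : Prop :=
  ∃ k, 1 ≤ k ∧ ∃ π, IsGapLabelling G k π

/-- The vertex-gap number: the least `k ≥ 1` for which `G` admits a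
gap-`[k]`-vertex-labelling. -/
noncomputable def vertexGapNumber {V : Type*} [Fintype V] (G : SimpleGraph V) : ℕ :=
  sInf {k | 1 ≤ k ∧ ∃ π, IsGapLabelling G k π}

open Finset in
/-- Any `k ≤ card V` vertices of smallest label form a set of size `k`. -/
theorem exists_card_eq_forall_label_le {V α : Type*} [Fintype V] [LinearOrder α] (π : V → α)
    (k : ℕ) (hk : k ≤ Fintype.card V) :
    ∃ A : Finset V, #A = k ∧ ∀ a ∈ A, ∀ x ∉ A, π a ≤ π x := by
  classical
  induction k with
  | zero => exact ⟨∅, by simp⟩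
  | succ k ih =>
    obtain ⟨A, hA, hle⟩ := ih (by omega)
    have hne : Aᶜ.Nonempty := by
      rw [← card_pos, card_compl]
      omega
    obtain ⟨b, hb, hmin⟩ := exists_min_image Aᶜ π hne
    rw [mem_compl] at hb
    refine ⟨insert b A, by rw [card_insert_of_notMem hb, hA], fun a ha x hx => ?_⟩
    rw [mem_insert, not_or] at hx
    rcases mem_insert.1 ha with rfl | ha
    · exact hmin x (mem_compl.2 hx.2)
    · exact hle a ha x hx.2

theorem mem_gapNbhd {V : Type*} [Fintype V] {G : SimpleGraph V} {u v : V} :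
    u ∈ gapNbhd G v ↔ G.Adj v u := by
  simp [gapNbhd]

/-- If a vertex `v` with at least two neighbours has a neighbour in a set `A` of vertices with
smallest labels and one in a set `B` of vertices with largest labels, then its colour is a
difference of a label from `B` and a label from `A`. -/
theorem exists_gapColor_eq_sub {V : Type*} [Fintype V] {G : SimpleGraph V} {π : V → ℕ} {v : V}
    {A B : Finset V} (hA : ∀ a ∈ A, ∀ x ∉ A, π a ≤ π x) (hB : ∀ b ∈ B, ∀ x ∉ B, π x ≤ π b)
    (hv : 2 ≤ (gapNbhd G v).card) (hvA : ∃ a ∈ A, G.Adj v a) (hvB : ∃ b ∈ B, G.Adj v b) :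
    ∃ a ∈ A, ∃ b ∈ B, gapColor G π v = π b - π a := by
  obtain ⟨a, haA, hva⟩ := hvA
  obtain ⟨b, hbB, hvb⟩ := hvB
  have hne : ((gapNbhd G v).image π).Nonempty :=
    ⟨π a, Finset.mem_image_of_mem _ (mem_gapNbhd.2 hva)⟩
  have hmin : ∃ a' ∈ A, ((gapNbhd G v).image π).min' hne = π a' := by
    obtain ⟨u, -, hu⟩ := Finset.mem_image.1 (Finset.min'_mem _ hne)
    by_cases huA : u ∈ A
    · exact ⟨u, huA, hu.symm⟩
    · exact ⟨a, haA, le_antisymm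
        (Finset.min'_le _ _ (Finset.mem_image_of_mem _ (mem_gapNbhd.2 hva)))
        (hu ▸ hA a haA u huA)⟩
  have hmax : ∃ b' ∈ B, ((gapNbhd G v).image π).max' hne = π b' := by
    obtain ⟨u, -, hu⟩ := Finset.mem_image.1 (Finset.max'_mem _ hne)
    by_cases huB : u ∈ B
    · exact ⟨u, huB, hu.symm⟩
    · exact ⟨b, hbB, le_antisymm (hu ▸ hB b hbB u huB)
        (Finset.le_max' _ _ (Finset.mem_image_of_mem _ (mem_gapNbhd.2 hvb)))⟩
  obtain ⟨a', ha', hmin⟩ := hmin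
  obtain ⟨b', hb', hmax⟩ := hmax
  refine ⟨a', ha', b', hb', ?_⟩
  rw [gapColor, dif_pos hne, if_pos hv, hmin, hmax]

open Classical in
/-- A set of more vertices than `v` has non-neighbours (counting `v` itself) contains a
neighbour of `v`. -/
theorem exists_adj_of_degree_compl_lt {V : Type*} [Fintype V] {G : SimpleGraph V} {v : V}
    {A : Finset V} (h : Gᶜ.degree v + 1 < A.card) : ∃ a ∈ A, G.Adj v a := by
  by_contra! hA
  have hsub : A ⊆ insert v (Gᶜ.neighborFinset v) := fun a ha => by
    rw [Finset.mem_insert, SimpleGraph.mem_neighborFinset, SimpleGraph.compl_adj]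
    by_cases hav : a = v
    · exact Or.inl hav
    · exact Or.inr ⟨Ne.symm hav, hA a ha⟩
  have h1 := Finset.card_le_card hsub
  have h2 := Finset.card_insert_le v (Gᶜ.neighborFinset v)
  rw [SimpleGraph.card_neighborFinset_eq_degree] at h2
  omega

open Classical in
theorem card_gapNbhd {V : Type*} [Fintype V] (G : SimpleGraph V) (v : V) :
    (gapNbhd G v).card = G.degree v := by
  rw [← SimpleGraph.card_neighborFinset_eq_degree]
  congr 1
  ext u
  rw [mem_gapNbhd, SimpleGraph.mem_neighborFinset]

open Classical in
/-- In a graph with a proper gap colouring, few vertices have small degree in the complement. -/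
theorem card_degree_compl_lt_le {V : Type*} [Fintype V] {G : SimpleGraph V} {π : V → ℕ}
    (hπ : ∀ u v, G.Adj u v → gapColor G π u ≠ gapColor G π v) (t : ℕ)
    (ht : t + 2 ≤ Fintype.card V) :
    (Finset.univ.filter fun v => Gᶜ.degree v < t).card ≤ t * (t + 1) ^ 2 := by
  obtain ⟨A, hAcard, hA⟩ := exists_card_eq_forall_label_le π (t + 1) (by omega)
  obtain ⟨B, hBcard, hB⟩ :=
    exists_card_eq_forall_label_le (fun v => OrderDual.toDual (π v)) (t + 1) (by omega)
  set W := Finset.univ.filter fun v => Gᶜ.degree v < t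
  have himage : (W.image (gapColor G π)).card ≤ (t + 1) ^ 2 := by
    have hsub : W.image (gapColor G π) ⊆ (A ×ˢ B).image fun p => π p.2 - π p.1 := by
      intro c hc
      obtain ⟨v, hv, rfl⟩ := Finset.mem_image.1 hc
      have hv : Gᶜ.degree v < t := (Finset.mem_filter.1 hv).2
      have hdeg : 2 ≤ (gapNbhd G v).card := by
        have := G.degree_compl v
        rw [card_gapNbhd]
        omega
      obtain ⟨a, ha, b, hb, hab⟩ := exists_gapColor_eq_sub hA hB hdeg
        (exists_adj_of_degree_compl_lt (by omega)) (exists_adj_of_degree_compl_lt (by omega))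
      exact Finset.mem_image.2 ⟨(a, b), Finset.mem_product.2 ⟨ha, hb⟩, hab.symm⟩
    refine (Finset.card_le_card hsub).trans (Finset.card_image_le.trans ?_)
    rw [Finset.card_product, hAcard, hBcard, sq]
  refine (Finset.card_le_mul_card_image W t fun c hc => ?_).trans (Nat.mul_le_mul_left t himage)
  obtain ⟨v, hv, rfl⟩ := Finset.mem_image.1 hc
  by_contra! hlt
  have hv : Gᶜ.degree v < t := (Finset.mem_filter.1 hv).2
  obtain ⟨u, hu, huv⟩ := exists_adj_of_degree_compl_lt (lt_of_le_of_lt hv hlt)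
  exact hπ v u huv (Finset.mem_filter.1 hu).2.symm

open Classical in
theorem sum_degree_compl {n : ℕ} (G : SimpleGraph (Fin n)) :
    ∑ v, Gᶜ.degree v = 2 * (n.choose 2 - G.edgeSet.ncard) := by
  have h1 := G.sum_degrees_eq_twice_card_edges
  have h2 : ∑ v, (Gᶜ.degree v + G.degree v) = n * (n - 1) := by
    rw [Finset.sum_congr rfl fun v _ => (?_ : Gᶜ.degree v + G.degree v = n - 1)]
    · simp
    · have := G.degree_compl v
      have := G.degree_lt_card_verts v
      simp only [Fintype.card_fin] at *
      omega
  have h3 : n.choose 2 * 2 = n * (n - 1) := by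
    rw [Nat.choose_two_right, Nat.div_two_mul_two_of_even (Nat.even_mul_pred_self n)]
  have h4 : G.edgeSet.ncard = G.edgeFinset.card := by
    rw [← SimpleGraph.coe_edgeFinset, Set.ncard_coe_finset]
  rw [Finset.sum_add_distrib] at h2
  omega

open Classical in
/-- A gap-vertex-labelable graph on `n` vertices misses at least `t (n - t (t + 1) ^ 2) / 2`
edges. -/
theorem mul_le_mul_add_two_mul_missing_edges {n : ℕ} {G : SimpleGraph (Fin n)}
    (h : GapVertexLabelable G) (t : ℕ) (ht : t + 2 ≤ n) :
    t * n ≤ t * (t * (t + 1) ^ 2) + 2 * (n.choose 2 - G.edgeSet.ncard) := by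
  obtain ⟨k, -, π, -, hπ⟩ := h
  set W := Finset.univ.filter fun v => Gᶜ.degree v < t with hWdef
  have hW : W.card ≤ t * (t + 1) ^ 2 := by
    convert card_degree_compl_lt_le hπ t (by simpa using ht)
  have hsum : ∑ _v ∈ Wᶜ, t ≤ ∑ v, Gᶜ.degree v :=
    (Finset.sum_le_sum fun v hv => by simpa [hWdef] using hv).trans
      (Finset.sum_le_sum_of_subset (Finset.subset_univ _))
  rw [sum_degree_compl, Finset.sum_const, smul_eq_mul] at hsum
  have hcard := W.card_add_card_compl
  rw [Fintype.card_fin] at hcard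
  have hmul := congrArg (t * ·) hcard
  simp only [mul_add] at hmul
  linarith [Nat.mul_le_mul_left t hW]

/-- The complete graph on at least four vertices is not gap-vertex-labelable. -/
theorem not_gapVertexLabelable_top {V : Type*} [Fintype V] (hV : 4 ≤ Fintype.card V) :
    ¬ GapVertexLabelable (⊤ : SimpleGraph V) := by
  classical
  rintro ⟨k, -, π, -, hπ⟩
  obtain ⟨A, hAcard, hA⟩ := exists_card_eq_forall_label_le π 1 (by omega)
  obtain ⟨B, hBcard, hB⟩ :=
    exists_card_eq_forall_label_le (fun v => OrderDual.toDual (π v)) 1 (by omega)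
  obtain ⟨a, rfl⟩ := Finset.card_eq_one.1 hAcard
  obtain ⟨b, rfl⟩ := Finset.card_eq_one.1 hBcard
  have hcolor : ∀ v, v ≠ a → v ≠ b → gapColor ⊤ π v = π b - π a := by
    intro v hva hvb
    have hdeg : 2 ≤ (gapNbhd (⊤ : SimpleGraph V) v).card := by
      have hcompl : gapNbhd (⊤ : SimpleGraph V) v = {v}ᶜ := by
        ext u
        simp [mem_gapNbhd, eq_comm]
      rw [hcompl, Finset.card_compl, Finset.card_singleton]
      omega
    obtain ⟨a', ha', b', hb', hab⟩ := exists_gapColor_eq_sub hA hB hdeg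
      ⟨a, by simp, by simpa using hva⟩ ⟨b, by simp, by simpa using hvb⟩
    rw [Finset.mem_singleton.1 ha', Finset.mem_singleton.1 hb'] at hab
    exact hab
  have hcard : 1 < ({a, b} : Finset V)ᶜ.card := by
    have := Finset.card_le_two (a := a) (b := b)
    rw [Finset.card_compl]
    omega
  obtain ⟨u, hu, v, hv, huv⟩ := Finset.one_lt_card.1 hcard
  simp only [Finset.mem_compl, Finset.mem_insert, Finset.mem_singleton, not_or] at hu hv
  exact hπ u v huv ((hcolor u hu.1 hu.2).trans (hcolor v hv.1 hv.2).symm)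

theorem missing_edges_pos {n : ℕ} (hn : 4 ≤ n) {G : SimpleGraph (Fin n)}
    (h : GapVertexLabelable G) : 1 ≤ n.choose 2 - G.edgeSet.ncard := by
  classical
  by_contra! hlt
  have hsum := sum_degree_compl G
  rw [Nat.lt_one_iff.1 hlt, mul_zero, Finset.sum_eq_zero_iff] at hsum
  have htop : G = ⊤ := by
    ext u v
    rw [SimpleGraph.top_adj]
    refine ⟨SimpleGraph.Adj.ne, fun huv => ?_⟩
    by_contra hadj
    have hpos : 0 < Gᶜ.degree u := (Gᶜ.degree_pos_iff_exists_adj u).2 ⟨v, huv, hadj⟩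
    exact hpos.ne' (hsum u (Finset.mem_univ u))
  exact not_gapVertexLabelable_top (by simpa using hn) (htop ▸ h)

/-- Lower bound on the gap-strength of `K_n`: for `n ≥ 4`, every gap-vertex-labelable simple
graph on `n` vertices is missing at least `(3/100) · n^{6/5}` of the `C(n,2)` possible edges.
Equivalently, `str_gap (K_n) ≥ (3/100) · n^{6/5}`, so `str_gap (K_n) ∈ Ω(n^{6/5})`. -/
theorem gapStrength_lower_bound (n : ℕ) (hn : 4 ≤ n) (G : SimpleGraph (Fin n))
    (h : GapVertexLabelable G) :
    (3 / 100 : ℝ) * (n : ℝ) ^ ((6 : ℝ) / 5) ≤ ((n.choose 2 - G.edgeSet.ncard : ℕ) : ℝ) := by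
  have hbound := mul_le_mul_add_two_mul_missing_edges h
  have hpos := missing_edges_pos hn h
  set m := n.choose 2 - G.edgeSet.ncard
  set x : ℝ := (n : ℝ) ^ ((1 : ℝ) / 5) with hx
  have hx0 : 0 ≤ x := by positivity
  have hx5 : x ^ 5 = n := by
    rw [hx, ← Real.rpow_natCast, ← Real.rpow_mul (by positivity)]
    norm_num
  have hx6 : (n : ℝ) ^ ((6 : ℝ) / 5) = n * x := by
    rw [← hx5, ← pow_succ, hx, ← Real.rpow_natCast, ← Real.rpow_mul (by positivity)]
    norm_num
  rw [hx6]
  rcases lt_or_ge n 32 with hn32 | hn32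
  · have hx2 : x ≤ 2 := by
      refine le_of_pow_le_pow_left₀ (n := 5) (by norm_num) (by norm_num) ?_
      rw [hx5]
      norm_num
      exact_mod_cast hn32.le
    have hnx : (n : ℝ) * x ≤ n * 2 := by gcongr
    have hm : 3 * n ≤ 50 * m := by
      have := hbound 1 (by omega)
      omega
    have hm : (3 * n : ℝ) ≤ 50 * m := by exact_mod_cast hm
    linarith
  · have hx2 : 2 ≤ x := by
      refine le_of_pow_le_pow_left₀ (n := 5) (by norm_num) hx0 ?_
      rw [hx5]
      norm_num
      exact_mod_cast hn32
    set t := ⌈x / 10⌉₊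
    have htl : x / 10 ≤ t := Nat.le_ceil _
    have htu : (t : ℝ) < x / 10 + 1 := Nat.ceil_lt_add_one (by positivity)
    have ht : (t : ℝ) * (t + 1) ^ 2 ≤ 2 / 5 * n := by
      calc (t : ℝ) * (t + 1) ^ 2 ≤ (3 / 5 * x) * (11 / 10 * x) ^ 2 := by
            gcongr <;> linarith
        _ = 363 / 500 * x ^ 3 * 1 := by ring
        _ ≤ 363 / 500 * x ^ 3 * (x ^ 2 / 4) := by
            gcongr
            nlinarith
        _ ≤ 2 / 5 * x ^ 5 := by
            have : 0 ≤ x ^ 5 := by positivity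
            nlinarith
        _ = 2 / 5 * n := by rw [hx5]
    have htn : t + 2 ≤ n := by
      have hn' : (32 : ℝ) ≤ n := by exact_mod_cast hn32
      have ht1 : (t : ℝ) ≤ t * (t + 1) ^ 2 :=
        le_mul_of_one_le_right (by positivity)
          (one_le_pow₀ (by linarith [Nat.cast_nonneg (α := ℝ) t]))
      have : (t : ℝ) + 2 ≤ n := by linarith
      exact_mod_cast this
    have hm : (t : ℝ) * n ≤ t * (t * (t + 1) ^ 2) + 2 * m := by exact_mod_cast hbound t htn
    have h1 : (t : ℝ) * (t * (t + 1) ^ 2) ≤ t * (2 / 5 * n) := by gcongr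
    have h2 : x / 10 * n ≤ t * n := by gcongr
    linarith
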